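/- arXiv:1909.05805 — 3 statements merged into one kernel-verified Lean document; each statement's English description precedes it below -/
import Mathlib

section
/- For every Delone set X in ℝ³, there exists a point x ∈ X such that every rotation in the 2R-cluster group S_x(2R) has order at most 6. -/
open Module Metric

section RotationOrder

variable {E : Type*} [NormedAddCommGroup E] [InnerProductSpace ℝ E]

/-- A linear isometry of a three-dimensional Euclidean space whose fixed space is a line acts on the
orthogonal complement of that line, identified with `ℂ`, as multiplication by a complex number. -/
theorem LinearIsometry.exists_complex_mul_of_fixed_line [Fact (finrank ℝ E = 2 + 1)]
    (L : E →ₗᵢ[ℝ] E) {d : E} (hd : ‖d‖ = 1) (hfix : ∀ v, L v = v ↔ ∃ t : ℝ, v = t • d) :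
    ∃ (φ : ℂ →ₗᵢ[ℝ] E) (a : ℂ), (∀ v, ∃ (z : ℂ) (t : ℝ), v = φ z + t • d) ∧
      (∀ z, inner ℝ d (φ z) = 0) ∧ ∀ z, L (φ z) = φ (a * z) := by
  have hd0 : d ≠ 0 := by rintro rfl; simp at hd
  have : FiniteDimensional ℝ E := .of_fact_finrank_eq_succ 2
  have hW : finrank ℝ (ℝ ∙ d)ᗮ = 2 := Submodule.finrank_orthogonal_span_singleton hd0
  let φ : ℂ ≃ₗᵢ[ℝ] (ℝ ∙ d)ᗮ :=
    Complex.orthonormalBasisOneI.equiv (stdOrthonormalBasis ℝ (ℝ ∙ d)ᗮ) (finCongr hW.symm)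
  have hLd : L d = d := (hfix d).2 ⟨1, by simp⟩
  have horth (z : ℂ) : inner ℝ d (φ z : E) = 0 :=
    Submodule.mem_orthogonal_singleton_iff_inner_right.1 (φ z).2
  have hL (w : (ℝ ∙ d)ᗮ) : L w ∈ (ℝ ∙ d)ᗮ := by
    rw [Submodule.mem_orthogonal_singleton_iff_inner_right]
    nth_rewrite 1 [← hLd]
    rw [L.inner_map_map]
    exact Submodule.mem_orthogonal_singleton_iff_inner_right.1 w.2
  let K : (ℝ ∙ d)ᗮ →ₗᵢ[ℝ] (ℝ ∙ d)ᗮ :=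
    { toLinearMap := (L.toLinearMap ∘ₗ (ℝ ∙ d)ᗮ.subtype).codRestrict _ hL
      norm_map' := fun w => L.norm_map w }
  let M : ℂ ≃ₗᵢ[ℝ] ℂ :=
    (φ.symm.toLinearIsometry.comp (K.comp φ.toLinearIsometry)).toLinearIsometryEquiv rfl
  have hM (z : ℂ) : L (φ z) = φ (M z) := by
    have : φ (M z) = K (φ z) := φ.apply_symm_apply _
    rw [this]; rfl
  have hMfix (z : ℂ) (hz : M z = z) : z = 0 := by
    have h1 := hM z
    rw [hz] at h1
    obtain ⟨t, ht⟩ := (hfix _).1 h1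
    have h2 := horth z
    rw [ht, inner_smul_right, real_inner_self_eq_norm_sq, hd] at h2
    have h3 : t = 0 := by simpa using h2
    rw [h3, zero_smul] at ht
    simpa using ht
  refine ⟨(ℝ ∙ d)ᗮ.subtypeₗᵢ.comp φ.toLinearIsometry, ?_⟩
  obtain ⟨a, ha | ha⟩ := linear_isometry_complex M
  · refine ⟨a, fun v => ?_, horth, fun z => ?_⟩
    · have hv : v - (inner ℝ d v : ℝ) • d ∈ (ℝ ∙ d)ᗮ := by
        rw [Submodule.mem_orthogonal_singleton_iff_inner_right, inner_sub_right, inner_smul_right,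
          real_inner_self_eq_norm_sq, hd]
        simp
      refine ⟨φ.symm ⟨_, hv⟩, inner ℝ d v, ?_⟩
      simp
    · have := hM z
      rw [ha, rotation_apply] at this
      exact this
  · exfalso
    have hconj (z : ℂ) : M z = a * (starRingEnd ℂ) z := by rw [ha]; rfl
    have haa : (a : ℂ) * (starRingEnd ℂ) a = 1 := by
      rw [Complex.mul_conj, Complex.normSq_eq_norm_sq, Circle.norm_coe]; simp
    by_cases h1 : (a : ℂ) = -1
    · refine Complex.I_ne_zero (hMfix _ ?_)
      rw [hconj, h1]; simp
    · refine h1 (eq_neg_of_add_eq_zero_left (hMfix (a + 1) ?_))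
      rw [hconj, map_add, mul_add, haa, map_one, mul_one, add_comm]

/-- If `g` is a rotation of order `n` about the line `x + ℝ d`, then every `n`-th root of unity acts
on the plane orthogonal to `d` as a power of `g`. -/
theorem IsometryEquiv.exists_pow_eq_mul_of_fixed_line [Fact (finrank ℝ E = 2 + 1)]
    (g : E ≃ᵢ E) {x d : E} (hd : ‖d‖ = 1) (hfix : ∀ p, g p = p ↔ ∃ t : ℝ, p = x + t • d)
    (hn : orderOf g ≠ 0) :
    ∃ φ : ℂ →ₗᵢ[ℝ] E, (∀ v, ∃ (z : ℂ) (t : ℝ), v = φ z + t • d) ∧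
      (∀ z, inner ℝ d (φ z) = 0) ∧
      ∀ ζ : ℂ, ζ ^ orderOf g = 1 → ∃ k : ℕ, ∀ (z : ℂ) (t : ℝ),
        (g ^ k) (x + (φ z + t • d)) = x + (φ (ζ * z) + t • d) := by
  let L := g.toRealAffineIsometryEquiv.linearIsometryEquiv
  have hx : g x = x := (hfix x).2 ⟨0, by simp⟩
  have hgL (v : E) : g (x + v) = x + L v := by
    have h := g.toRealAffineIsometryEquiv.map_vadd x v
    simp only [vadd_eq_add, IsometryEquiv.coeFn_toRealAffineIsometryEquiv] at h
    rw [add_comm x v, h, hx, add_comm]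
  have hLfix (v : E) : L v = v ↔ ∃ t : ℝ, v = t • d := by
    have := hfix (x + v)
    simpa [hgL] using this
  obtain ⟨φ, a, hdec, horth, hφ⟩ :=
    LinearIsometry.exists_complex_mul_of_fixed_line L.toLinearIsometry hd hLfix
  have hpow (k : ℕ) (z : ℂ) (t : ℝ) :
      (g ^ k) (x + (φ z + t • d)) = x + (φ (a ^ k * z) + t • d) := by
    induction k with
    | zero => simp
    | succ k ih =>
      have h1 : L (φ (a ^ k * z)) = φ (a * (a ^ k * z)) := hφ _
      have h2 : L (t • d) = t • d := (hLfix _).2 ⟨t, rfl⟩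
      rw [pow_succ', IsometryEquiv.mul_apply, ih, hgL, map_add, h1, h2, pow_succ', mul_assoc]
  have hiff (k : ℕ) : a ^ k = 1 ↔ g ^ k = 1 := by
    refine ⟨fun h => IsometryEquiv.ext fun p => ?_, fun h => ?_⟩
    · obtain ⟨z, t, hzt⟩ := hdec (p - x)
      have := hpow k z t
      rw [h, one_mul, ← hzt] at this
      simpa using this
    · have := hpow k 1 0
      rw [h] at this
      have h1 : φ 1 = φ (a ^ k) := by simpa using this
      exact (φ.injective h1).symm
  have hprim : IsPrimitiveRoot a (orderOf g) :=
    IsPrimitiveRoot.iff_def _ _ |>.2 ⟨(hiff _).2 (pow_orderOf_eq_one g),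
      fun k hk => orderOf_dvd_of_pow_eq_one ((hiff k).1 hk)⟩
  refine ⟨φ, hdec, horth, fun ζ hζ => ?_⟩
  have : NeZero (orderOf g) := ⟨hn⟩
  obtain ⟨k, -, hk⟩ := hprim.eq_pow_of_pow_eq_one hζ
  exact ⟨k, fun z t => hk ▸ hpow k z t⟩

/-- For `n ≥ 7` there is an `n`-th root of unity at distance at most `9 / 10` from `1`. -/
theorem Complex.exists_pow_eq_one_norm_sub_one_le {n : ℕ} (hn : 7 ≤ n) :
    ∃ ζ : ℂ, ζ ^ n = 1 ∧ ζ.re ≠ 1 ∧ ζ.im ≠ 0 ∧ ‖ζ - 1‖ ≤ 9 / 10 := by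
  have hn0 : n ≠ 0 := by omega
  have hn' : (7 : ℝ) ≤ n := by exact_mod_cast hn
  have hpos : 0 < 2 * Real.pi / n := by have := Real.pi_pos; positivity
  have hle : 2 * Real.pi / n ≤ 9 / 10 := by
    rw [div_le_iff₀ (by linarith)]
    linarith [Real.pi_lt_d2]
  have hsin : 0 < Real.sin (2 * Real.pi / n) :=
    Real.sin_pos_of_pos_of_lt_pi hpos (by linarith [Real.pi_gt_three])
  have hexp : Complex.exp (2 * Real.pi * Complex.I / n) =
      Complex.exp (Complex.I * ((2 * Real.pi / n : ℝ) : ℂ)) := by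
    congr 1; push_cast; ring
  have him : (Complex.exp (Complex.I * ((2 * Real.pi / n : ℝ) : ℂ))).im =
      Real.sin (2 * Real.pi / n) := by
    rw [mul_comm, Complex.exp_ofReal_mul_I_im]
  have hre : (Complex.exp (Complex.I * ((2 * Real.pi / n : ℝ) : ℂ))).re =
      Real.cos (2 * Real.pi / n) := by
    rw [mul_comm, Complex.exp_ofReal_mul_I_re]
  refine ⟨_, (Complex.isPrimitiveRoot_exp n hn0).pow_eq_one, ?_, ?_, ?_⟩
  · rw [hexp, hre]
    intro h
    have := Real.sin_sq_add_cos_sq (2 * Real.pi / n)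
    rw [h] at this
    nlinarith
  · rw [hexp, him]
    exact hsin.ne'
  · rw [hexp]
    refine Real.norm_exp_I_mul_ofReal_sub_one_le.trans ?_
    rwa [Real.norm_of_nonneg hpos.le]

/-- If `q` is off the axis of a rotation about `x` of order at least `7`, then for every line through
`q` some power of the rotation moves `q` off that line by at most `9 / 10` of its distance to
`x`. -/
theorem IsometryEquiv.exists_pow_dist_le_of_seven_le_orderOf [Fact (finrank ℝ E = 2 + 1)]
    (g : E ≃ᵢ E) {x d : E} (hd : ‖d‖ = 1) (hfix : ∀ p, g p = p ↔ ∃ t : ℝ, p = x + t • d)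
    (hn : 7 ≤ orderOf g) {q : E} (hq : ¬ ∃ t : ℝ, q = x + t • d) (e : E) :
    ∃ k : ℕ, dist q ((g ^ k) q) ≤ 9 / 10 * dist x q ∧ ¬ ∃ t : ℝ, (g ^ k) q = q + t • e := by
  obtain ⟨φ, hdec, horth, hroot⟩ := g.exists_pow_eq_mul_of_fixed_line hd hfix (by omega)
  obtain ⟨ζ, hζ, hre, him, hnorm⟩ := Complex.exists_pow_eq_one_norm_sub_one_le hn
  obtain ⟨z, t, hzt⟩ := hdec (q - x)
  have hqx : q = x + (φ z + t • d) := by rw [← hzt]; abel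
  have hz : z ≠ 0 := by
    rintro rfl
    exact hq ⟨t, by simpa using hqx⟩
  have hzq : ‖z‖ ≤ dist x q := by
    rw [dist_comm, dist_eq_norm, hzt, ← φ.norm_map z]
    refine le_of_sq_le_sq ?_ (norm_nonneg _)
    rw [norm_add_sq_real, inner_smul_right, real_inner_comm, horth]
    nlinarith [sq_nonneg ‖t • d‖]
  have hdiff (ξ : ℂ) : x + (φ (ξ * z) + t • d) - q = φ ((ξ - 1) * z) := by
    rw [hqx, sub_mul, one_mul, map_sub]; abel
  have hdist (ξ : ℂ) (hξ : ‖ξ - 1‖ ≤ 9 / 10) :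
      dist q (x + (φ (ξ * z) + t • d)) ≤ 9 / 10 * dist x q := by
    rw [dist_comm, dist_eq_norm, hdiff, φ.norm_map, norm_mul]
    gcongr
  have hζ' : (starRingEnd ℂ) ζ ^ orderOf g = 1 := by rw [← map_pow, hζ, map_one]
  have hnorm' : ‖(starRingEnd ℂ) ζ - 1‖ ≤ 9 / 10 := by
    rwa [← map_one (starRingEnd ℂ), ← map_sub, RCLike.norm_conj]
  obtain ⟨k, hk⟩ := hroot ζ hζ
  obtain ⟨l, hl⟩ := hroot _ hζ'
  have hkq : (g ^ k) q = x + (φ (ζ * z) + t • d) := by rw [← hk, ← hqx]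
  have hlq : (g ^ l) q = x + (φ ((starRingEnd ℂ) ζ * z) + t • d) := by rw [← hl, ← hqx]
  by_cases hke : ∃ t : ℝ, (g ^ k) q = q + t • e
  · refine ⟨l, hlq ▸ hdist _ hnorm', fun hle => ?_⟩
    obtain ⟨s, hs⟩ := hke
    obtain ⟨r, hr⟩ := hle
    have h1 : φ ((ζ - 1) * z) = s • e := by rw [← hdiff, ← hkq, hs]; abel
    have h2 : φ (((starRingEnd ℂ) ζ - 1) * z) = r • e := by rw [← hdiff, ← hlq, hr]; abel
    have h3 : φ (r • ((ζ - 1) * z)) = φ (s • (((starRingEnd ℂ) ζ - 1) * z)) := by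
      rw [map_smul, map_smul, h1, h2, smul_comm]
    have h4 : (r : ℂ) * (ζ - 1) = s * ((starRingEnd ℂ) ζ - 1) := by
      have := φ.injective h3
      rw [Complex.real_smul, Complex.real_smul, ← mul_assoc, ← mul_assoc] at this
      exact mul_right_cancel₀ hz this
    have h5 : r * (ζ.re - 1) = s * (ζ.re - 1) := by simpa using congrArg Complex.re h4
    have h6 : r * ζ.im = -(s * ζ.im) := by simpa using congrArg Complex.im h4
    have h7 : r = s := mul_right_cancel₀ (sub_ne_zero.2 hre) h5
    have h8 : s = 0 := by
      have : s * ζ.im = 0 := by rw [h7] at h6; linarith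
      exact (mul_eq_zero.1 this).resolve_right him
    rw [h8, zero_smul] at h1
    have h9 : (ζ - 1) * z = 0 := φ.injective (by rw [h1, map_zero])
    refine hre ?_
    rw [sub_eq_zero.1 ((mul_eq_zero.1 h9).resolve_right hz), Complex.one_re]
  · exact ⟨k, hkq ▸ hdist _ hnorm, hke⟩

/-- The powers of a permutation preserving a set map the set into itself. -/
theorem IsometryEquiv.pow_apply_mem_of_image_eq {α : Type*} [PseudoEMetricSpace α] {g : α ≃ᵢ α}
    {C : Set α} (hC : g '' C = C) {q : α} (hq : q ∈ C) (k : ℕ) : (g ^ k) q ∈ C := by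
  induction k with
  | zero => simpa
  | succ k ih =>
    rw [pow_succ', IsometryEquiv.mul_apply, ← hC]
    exact Set.mem_image_of_mem g ih

/-- In a Delone set with covering radius `R`, the points within `2 * R` of any given point of the
set do not all lie on one line through it. -/
theorem exists_mem_dist_le_two_mul_notMem_line [Fact (finrank ℝ E = 2 + 1)]
    {R : ℝ} {X : Set E}
    (hpack : ∀ x ∈ X, ∀ y ∈ X, x ≠ y → 1 ≤ dist x y)
    (hcover : ∀ p : E, ∃ q ∈ X, dist p q ≤ R) (x : E) {d : E} (hd : ‖d‖ = 1) :
    ∃ q ∈ X, dist x q ≤ 2 * R ∧ ¬ ∃ t : ℝ, q = x + t • d := by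
  have hd0 : d ≠ 0 := by rintro rfl; simp at hd
  have : FiniteDimensional ℝ E := .of_fact_finrank_eq_succ 2
  have hR : 0 ≤ R := by
    obtain ⟨q, -, hq⟩ := hcover x
    exact dist_nonneg.trans hq
  obtain ⟨u, hu, hdu⟩ : ∃ u : E, ‖u‖ = 1 ∧ inner ℝ d u = 0 := by
    have hW : finrank ℝ (ℝ ∙ d)ᗮ = 2 := Submodule.finrank_orthogonal_span_singleton hd0
    have : Nontrivial (ℝ ∙ d)ᗮ := finrank_pos_iff.1 (by omega : 0 < finrank ℝ (ℝ ∙ d)ᗮ)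
    obtain ⟨u, hu⟩ := exists_norm_eq (ℝ ∙ d)ᗮ zero_le_one
    exact ⟨u, hu, Submodule.mem_orthogonal_singleton_iff_inner_right.1 u.2⟩
  have hnear (ε : ℝ) (hε : 0 < ε) :
      ∃ q ∈ X, dist x q ≤ 2 * R + ε ∧ ¬ ∃ t : ℝ, q = x + t • d := by
    obtain ⟨q, hqX, hq⟩ := hcover (x + (R + ε) • u)
    refine ⟨q, hqX, ?_, ?_⟩
    · have h1 : dist x (x + (R + ε) • u) = R + ε := by
        rw [dist_self_add_right, norm_smul, hu, mul_one, Real.norm_of_nonneg (by linarith)]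
      linarith [dist_triangle x (x + (R + ε) • u) q]
    · rintro ⟨t, rfl⟩
      rw [dist_add_left, dist_eq_norm] at hq
      have h1 : ‖(R + ε) • u - t • d‖ ^ 2 = (R + ε) ^ 2 + t ^ 2 := by
        rw [norm_sub_sq_real, inner_smul_left, inner_smul_right, real_inner_comm, hdu, norm_smul,
          norm_smul, hu, hd]
        simp
      nlinarith [norm_nonneg ((R + ε) • u - t • d), sq_nonneg t]
  let F := {q ∈ closedBall x (2 * R + 1) ∩ X | ¬ ∃ t : ℝ, q = x + t • d}
  have hXclosed : IsClosed X := isClosed_of_pairwise_le_dist one_pos fun a ha b hb => hpack a ha b hb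
  have hXdisc : IsDiscrete X :=
    ⟨DiscreteTopology.of_forall_le_dist one_pos fun a b hab =>
      hpack a a.2 b b.2 (Subtype.coe_injective.ne hab)⟩
  have hF : F.Finite :=
    (finite_isBounded_inter_isClosed hXdisc isBounded_closedBall hXclosed).subset
      fun q hq => hq.1
  have hmemF {q : E} {ε : ℝ} (hε : ε ≤ 1) (hqX : q ∈ X) (hq : dist x q ≤ 2 * R + ε)
      (hqd : ¬ ∃ t : ℝ, q = x + t • d) : q ∈ F :=
    ⟨⟨mem_closedBall'.2 (by linarith), hqX⟩, hqd⟩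
  obtain ⟨q₁, hq₁X, hq₁, hq₁d⟩ := hnear 1 one_pos
  obtain ⟨q, hqF, hqmin⟩ := F.exists_min_image (dist x) hF ⟨q₁, hmemF le_rfl hq₁X hq₁ hq₁d⟩
  refine ⟨q, hqF.1.2, le_of_forall_pos_le_add fun ε hε => ?_, hqF.2⟩
  obtain ⟨p, hpX, hp, hpd⟩ := hnear (min ε 1) (lt_min hε one_pos)
  have h1 := hqmin p (hmemF (min_le_right _ _) hpX hp hpd)
  linarith [min_le_left ε 1]

end RotationOrder


/-- For every Delone set `X ⊂ ℝ³` there is a point `x ∈ X` such that every rotation in the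
`2R`-cluster group `S_x(2R)` (an isometry fixing `x`, preserving `C_x(2R) = X ∩ B_x(2R)`,
and whose fixed-point set is exactly a line through `x`) has order at most `6`. -/
theorem delone_exists_point_rotation_order_le_six
    (R : ℝ) (hR : (1:ℝ)/2 ≤ R) (X : Set (EuclideanSpace ℝ (Fin 3)))
    (hpack : ∀ x ∈ X, ∀ y ∈ X, x ≠ y → 1 ≤ dist x y)
    (hcover : ∀ p : EuclideanSpace ℝ (Fin 3), ∃ q ∈ X, dist p q ≤ R) :
    ∃ x ∈ X, ∀ g : EuclideanSpace ℝ (Fin 3) ≃ᵢ EuclideanSpace ℝ (Fin 3),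
      g x = x →
      g '' (X ∩ Metric.closedBall x (2 * R)) = X ∩ Metric.closedBall x (2 * R) →
      (∃ d : EuclideanSpace ℝ (Fin 3), ‖d‖ = 1 ∧
        ∀ p, g p = p ↔ ∃ t : ℝ, p = x + t • d) →
      orderOf g ≤ 6 := by
  have : Fact (finrank ℝ (EuclideanSpace ℝ (Fin 3)) = 2 + 1) := ⟨by simp⟩
  by_contra! hcon
  have hdescent (k : ℕ) : ∃ x ∈ X, ∀ d : EuclideanSpace ℝ (Fin 3), ‖d‖ = 1 →
      ∃ q ∈ X, dist x q ≤ (9 / 10) ^ k * (2 * R) ∧ ¬ ∃ t : ℝ, q = x + t • d := by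
    induction k with
    | zero =>
      obtain ⟨x, hxX, -⟩ := hcover 0
      refine ⟨x, hxX, fun d hd => ?_⟩
      rw [pow_zero, one_mul]
      exact exists_mem_dist_le_two_mul_notMem_line hpack hcover x hd
    | succ k ih =>
      obtain ⟨x, hxX, hx⟩ := ih
      obtain ⟨g, hgx, hgC, ⟨d, hd, hfix⟩, hg⟩ := hcon x hxX
      obtain ⟨q, hqX, hq, hqd⟩ := hx d hd
      have hqR : dist x q ≤ 2 * R :=
        hq.trans (mul_le_of_le_one_left (by linarith) (pow_le_one₀ (by norm_num) (by norm_num)))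
      refine ⟨q, hqX, fun e _ => ?_⟩
      obtain ⟨l, hl, hle⟩ := g.exists_pow_dist_le_of_seven_le_orderOf hd hfix hg hqd e
      have hmem := IsometryEquiv.pow_apply_mem_of_image_eq hgC ⟨hqX, mem_closedBall'.2 hqR⟩ l
      refine ⟨_, hmem.1, hl.trans ?_, hle⟩
      rw [pow_succ', mul_assoc]
      gcongr
  obtain ⟨k, hk⟩ := exists_pow_lt_of_lt_one (by positivity : 0 < 1 / (2 * R))
    (by norm_num : (9 / 10 : ℝ) < 1)
  obtain ⟨x, hxX, hx⟩ := hdescent k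
  obtain ⟨d, hd⟩ := exists_norm_eq (EuclideanSpace ℝ (Fin 3)) zero_le_one
  obtain ⟨q, hqX, hq, hqd⟩ := hx d hd
  have hne : x ≠ q := by
    rintro rfl
    exact hqd ⟨0, by simp⟩
  rw [lt_div_iff₀ (by linarith)] at hk
  linarith [hpack x hxX q hqX hne]
end

section
/- Let X ⊂ ℝ³ be a Delone set in which all 2R-clusters are mutually equivalent, and suppose some (equivalently, every) 2R-cluster group S_x(2R) contains a rotation of order n. Then n ≤ 6. -/
open scoped RealInnerProductSpace in
/-- A linear isometry of a three-dimensional Euclidean space fixing exactly the line spanned by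
the unit vector `d` acts on the orthogonal plane as multiplication by a complex number. -/
theorem LinearIsometryEquiv.exists_complex_coordinate_of_fixed_line {E : Type*}
    [NormedAddCommGroup E] [InnerProductSpace ℝ E] [Fact (Module.finrank ℝ E = 2 + 1)]
    (L : E ≃ₗᵢ[ℝ] E) {d : E} (hd : ‖d‖ = 1) (hL : ∀ v, L v = v ↔ ∃ t : ℝ, v = t • d) :
    ∃ (T : E →ₗ[ℝ] ℂ) (a : ℂ), Function.Surjective T ∧ (∀ v, ‖T v‖ ≤ ‖v‖) ∧
      (∀ v, T (L v) = a * T v) ∧ (∀ v, T v = 0 ↔ ∃ t : ℝ, v = t • d) ∧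
      (∀ v, ⟪d, v⟫ = 0 → ‖T v‖ = ‖v‖) ∧ (∀ v, ⟪d, L v⟫ = ⟪d, v⟫) := by
  have hd0 : d ≠ 0 := by
    rintro rfl
    simp at hd
  have : FiniteDimensional ℝ E := Module.finite_of_finrank_eq_succ (Fact.out : _ = 2 + 1)
  have hLd : L d = d := (hL d).2 ⟨1, by simp⟩
  have hLinner (v : E) : ⟪d, L v⟫ = ⟪d, v⟫ := by
    conv_lhs => rw [← hLd]
    exact L.inner_map_map d v
  have hmem (v : E) : v ∈ (ℝ ∙ d)ᗮ ↔ ⟪d, v⟫ = 0 := Submodule.mem_orthogonal_singleton_iff_inner_right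
  have hfin : Module.finrank ℝ (ℝ ∙ d)ᗮ = 2 := Submodule.finrank_orthogonal_span_singleton hd0
  let e : (ℝ ∙ d)ᗮ ≃ₗᵢ[ℝ] ℂ :=
    (stdOrthonormalBasis ℝ (ℝ ∙ d)ᗮ).equiv Complex.orthonormalBasisOneI (finCongr hfin)
  have hmaps (v : E) (hv : v ∈ (ℝ ∙ d)ᗮ) : L.toLinearEquiv.toLinearMap v ∈ (ℝ ∙ d)ᗮ := by
    rw [hmem] at hv ⊢
    exact (hLinner v).trans hv
  let M : (ℝ ∙ d)ᗮ →ₗᵢ[ℝ] (ℝ ∙ d)ᗮ :=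
    ⟨L.toLinearEquiv.toLinearMap.restrict hmaps, fun v => L.norm_map v⟩
  have hM (v : (ℝ ∙ d)ᗮ) : (M v : E) = L v := rfl
  let f : ℂ ≃ₗᵢ[ℝ] ℂ := e.symm.trans ((M.toLinearIsometryEquiv rfl).trans e)
  have hf (v : (ℝ ∙ d)ᗮ) : f (e v) = e (M v) := by simp [f]
  have hfix (z : ℂ) (hz : f z = z) : z = 0 := by
    obtain ⟨v, rfl⟩ := e.surjective z
    rw [hf] at hz
    have h1 : L v = (v : E) := congrArg Subtype.val (e.injective hz)
    obtain ⟨t, ht⟩ := (hL v).1 h1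
    have h2 := (hmem v).1 v.2
    rw [ht, inner_smul_right, real_inner_self_eq_norm_sq, hd] at h2
    have h3 : v = 0 := by
      apply Subtype.ext
      rw [ht, show t = 0 by simpa using h2]
      simp
    simp [h3]
  have hrot : ∃ a : ℂ, ∀ z, f z = a * z := by
    obtain ⟨a, ha | ha⟩ := linear_isometry_complex f
    · exact ⟨a, fun z => by simp [ha]⟩
    · exfalso
      obtain ⟨b, hb⟩ := IsAlgClosed.exists_pow_nat_eq (a : ℂ) (n := 2) two_pos
      have hnb : ‖b‖ = 1 := by
        have h1 : ‖b‖ ^ 2 = 1 := by rw [← norm_pow, hb, Circle.norm_coe]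
        exact (pow_eq_one_iff_of_nonneg (norm_nonneg b) two_ne_zero).1 h1
      have h2 : f b = b := by
        have h3 : b * (starRingEnd ℂ) b = 1 := by rw [Complex.mul_conj']; simp [hnb]
        rw [ha]
        simp only [LinearIsometryEquiv.trans_apply, rotation_apply, Complex.conjLIE_apply]
        rw [← hb]
        linear_combination b * h3
      rw [hfix b h2] at hnb
      simp at hnb
  obtain ⟨a, ha⟩ := hrot
  have hproj (v : E) : ∃ (p : (ℝ ∙ d)ᗮ) (t : ℝ), v = p + t • d ∧
      (ℝ ∙ d)ᗮ.orthogonalProjectionOnto v = p := by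
    refine ⟨(ℝ ∙ d)ᗮ.orthogonalProjectionOnto v, ⟪d, v⟫, ?_, rfl⟩
    rw [add_comm, ← Submodule.starProjection_unit_singleton ℝ hd v]
    exact ((ℝ ∙ d).starProjection_add_starProjection_orthogonal v).symm
  have hprojd : (ℝ ∙ d)ᗮ.orthogonalProjectionOnto d = 0 :=
    Submodule.orthogonalProjectionOnto_orthogonal_apply_eq_zero
      (Submodule.mem_span_singleton_self d)
  refine ⟨e.toLinearEquiv.toLinearMap ∘ₗ (ℝ ∙ d)ᗮ.orthogonalProjectionOnto.toLinearMap, a,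
    ?_, ?_, ?_, ?_, ?_, hLinner⟩
  · intro z
    exact ⟨e.symm z, by simp⟩
  · intro v
    exact (e.norm_map _).trans_le (Submodule.norm_orthogonalProjectionOnto_apply_le _ v)
  · intro v
    obtain ⟨p, t, hv, hp⟩ := hproj v
    have h1 : (ℝ ∙ d)ᗮ.orthogonalProjectionOnto (L v) = M p := by
      rw [hv, map_add, map_smul, hLd, ContinuousLinearMap.map_add, ContinuousLinearMap.map_smul,
        hprojd, ← hM,
        Submodule.orthogonalProjectionOnto_mem_subspace_eq_self, smul_zero, add_zero]
    have h2 := hf p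
    rw [ha] at h2
    simpa [h1, hp] using h2.symm
  · intro v
    constructor
    · intro hv
      obtain ⟨p, t, hvp, hp⟩ := hproj v
      have h1 : p = 0 := by simpa [hp] using hv
      exact ⟨t, by simpa [h1] using hvp⟩
    · rintro ⟨t, rfl⟩
      simp [hprojd]
  · intro v hv
    have h1 := Submodule.orthogonalProjectionOnto_mem_subspace_eq_self (⟨v, (hmem v).2 hv⟩ : (ℝ ∙ d)ᗮ)
    simp only at h1
    simp [h1]

/-- A uniformly discrete set meets every closed ball in a finite set. -/
theorem finite_inter_closedBall_of_one_le_dist {E : Type*} [PseudoMetricSpace E] [ProperSpace E]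
    {X : Set E} (hpack : ∀ x ∈ X, ∀ y ∈ X, x ≠ y → 1 ≤ dist x y) (x : E) (r : ℝ) :
    (X ∩ Metric.closedBall x r).Finite := by
  obtain ⟨t, ht, hcov⟩ := Metric.totallyBounded_iff.1 (isCompact_closedBall x r).totallyBounded
    (1 / 2) (by norm_num)
  refine (ht.biUnion (t := fun c => X ∩ Metric.ball c (1 / 2)) fun c _ => ?_).subset ?_
  · refine Set.Subsingleton.finite fun y hy z hz => ?_
    by_contra hne
    have h1 := hpack y hy.1 z hz.1 hne
    have h2 := dist_triangle_right y z c
    have h3 := Metric.mem_ball.1 hy.2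
    have h4 := Metric.mem_ball.1 hz.2
    linarith
  · rintro y ⟨hyX, hy⟩
    obtain ⟨c, hc, hyc⟩ := Set.mem_iUnion₂.1 (hcov hy)
    exact Set.mem_iUnion₂.2 ⟨c, hc, hyX, hyc⟩

open scoped RealInnerProductSpace in
/-- In a Delone set, every cluster of radius `2 * R` has a point strictly on a given side of each
hyperplane through its centre. -/
theorem exists_mem_closedBall_two_mul_inner_pos {E : Type*} [NormedAddCommGroup E]
    [InnerProductSpace ℝ E] [ProperSpace E] {X : Set E} {R : ℝ} (hR : 0 ≤ R)
    (hpack : ∀ x ∈ X, ∀ y ∈ X, x ≠ y → 1 ≤ dist x y) (hcover : ∀ p, ∃ q ∈ X, dist p q ≤ R)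
    (x : E) {u : E} (hu : ‖u‖ = 1) :
    ∃ q ∈ X, dist q x ≤ 2 * R ∧ 0 < ⟪u, q - x⟫ := by
  have hF : (X ∩ Metric.closedBall x (2 * R + 1)).Finite :=
    finite_inter_closedBall_of_one_le_dist hpack x _
  have hev : ∀ᶠ t in nhdsWithin R (Set.Ioi R), ∀ q ∈ X ∩ Metric.closedBall x (2 * R + 1),
      2 * R < dist q x → t + R < dist q x := by
    rw [Filter.eventually_all_finite hF]
    intro q _
    by_cases hq : 2 * R < dist q x
    · have : Set.Iio (dist q x - R) ∈ nhds R := Iio_mem_nhds (by linarith)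
      filter_upwards [mem_nhdsWithin_of_mem_nhds this] with t ht _
      linarith [Set.mem_Iio.1 ht]
    · exact Filter.Eventually.of_forall fun t h => absurd h hq
  have hlt : ∀ᶠ t in nhdsWithin R (Set.Ioi R), t < R + 1 :=
    mem_nhdsWithin_of_mem_nhds (Iio_mem_nhds (by linarith))
  obtain ⟨t, ⟨ht, ht1⟩, htR⟩ := ((hev.and hlt).and self_mem_nhdsWithin).exists
  have htR : R < t := htR
  obtain ⟨q, hqX, hq⟩ := hcover (x + t • u)
  have hqx : dist q x ≤ t + R := by
    have h1 := dist_triangle_left q x (x + t • u)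
    have h2 : dist (x + t • u) x = t := by
      simp [norm_smul, hu, abs_of_nonneg (hR.trans htR.le)]
    linarith
  refine ⟨q, hqX, ?_, ?_⟩
  · by_contra! h
    have := ht q ⟨hqX, Metric.mem_closedBall.2 (by linarith)⟩ h
    linarith
  · have h1 : ⟪u, x + t • u - q⟫ ≤ R := by
      refine (real_inner_le_norm _ _).trans ?_
      rw [hu, one_mul, ← dist_eq_norm]
      exact hq
    have h2 : ⟪u, q - x⟫ = t - ⟪u, x + t • u - q⟫ := by
      rw [show q - x = t • u - (x + t • u - q) by abel, inner_sub_right, inner_smul_right,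
        real_inner_self_eq_norm_sq, hu]
      ring
    linarith

/-- For `n ≥ 7` there is a non-real `n`-th root of unity at distance less than `1` from `1`. -/
theorem exists_root_of_unity_norm_sub_one_lt_one {n : ℕ} (hn : 7 ≤ n) :
    ∃ z : ℂ, z ^ n = 1 ∧ ‖z‖ = 1 ∧ z.im ≠ 0 ∧ ‖z - 1‖ < 1 := by
  have hn' : (7 : ℝ) ≤ n := by exact_mod_cast hn
  have hn0 : (0 : ℝ) < n := by linarith
  have hpi := Real.pi_pos
  have hz : Complex.exp (2 * Real.pi * Complex.I / n) =
      Complex.exp ((2 * Real.pi / n : ℝ) * Complex.I) := by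
    congr 1
    push_cast
    ring
  have hθ0 : 0 < 2 * Real.pi / n := by positivity
  have hθ : 2 * Real.pi / n < Real.pi / 3 := by
    rw [div_lt_div_iff₀ hn0 (by norm_num)]
    nlinarith
  refine ⟨_, (Complex.isPrimitiveRoot_exp n (by omega)).pow_eq_one, ?_, ?_, ?_⟩
  · rw [hz, Complex.norm_exp_ofReal_mul_I]
  · rw [hz, Complex.exp_ofReal_mul_I_im]
    exact (Real.sin_pos_of_pos_of_lt_pi hθ0 (by linarith)).ne'
  · rw [hz]
    have hcos := Real.cos_lt_cos_of_nonneg_of_le_pi_div_two hθ0.le (by linarith) hθ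
    rw [Real.cos_pi_div_three] at hcos
    have h1 := Real.sin_sq_add_cos_sq (2 * Real.pi / n)
    have h2 : ‖Complex.exp ((2 * Real.pi / n : ℝ) * Complex.I) - 1‖ ^ 2 < 1 := by
      rw [Complex.sq_norm, Complex.normSq_apply, Complex.sub_re, Complex.sub_im,
        Complex.exp_ofReal_mul_I_re, Complex.exp_ofReal_mul_I_im]
      simp only [Complex.one_re, Complex.one_im]
      nlinarith
    exact (sq_lt_one_iff₀ (norm_nonneg _)).1 h2


/-- Let `X ⊂ ℝ³` be a Delone set all of whose `2R`-clusters are mutually equivalent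
(`N(2R) = 1`). If some `2R`-cluster group `S_x(2R)` contains a rotation of order `n`
(an isometry fixing `x`, preserving `C_x(2R)`, whose fixed-point set is exactly a line
through `x`, and of order `n`), then `n ≤ 6`. -/
theorem delone_equivalent_clusters_rotation_order_le_six
    (R : ℝ) (hR : (1:ℝ)/2 ≤ R) (X : Set (EuclideanSpace ℝ (Fin 3)))
    (hpack : ∀ x ∈ X, ∀ y ∈ X, x ≠ y → 1 ≤ dist x y)
    (hcover : ∀ p : EuclideanSpace ℝ (Fin 3), ∃ q ∈ X, dist p q ≤ R)
    (hequiv : ∀ x ∈ X, ∀ x' ∈ X,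
      ∃ g : EuclideanSpace ℝ (Fin 3) ≃ᵢ EuclideanSpace ℝ (Fin 3), g x = x' ∧
        g '' (X ∩ Metric.closedBall x (2 * R)) = X ∩ Metric.closedBall x' (2 * R))
    (x : EuclideanSpace ℝ (Fin 3)) (hx : x ∈ X)
    (n : ℕ)
    (g : EuclideanSpace ℝ (Fin 3) ≃ᵢ EuclideanSpace ℝ (Fin 3))
    (hgx : g x = x)
    (hg : g '' (X ∩ Metric.closedBall x (2 * R)) = X ∩ Metric.closedBall x (2 * R))
    (hrot : ∃ d : EuclideanSpace ℝ (Fin 3), ‖d‖ = 1 ∧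
      ∀ p, g p = p ↔ ∃ t : ℝ, p = x + t • d)
    (horder : orderOf g = n) :
    n ≤ 6 := by
  obtain ⟨d, hd, hfix⟩ := hrot
  by_contra! hn
  let E := EuclideanSpace ℝ (Fin 3)
  have : Fact (Module.finrank ℝ E = 2 + 1) := ⟨by simp [E]⟩
  -- The linear part of `g`, and the coordinate in the plane orthogonal to its axis.
  let L : E ≃ₗᵢ[ℝ] E := g.toRealAffineIsometryEquiv.linearIsometryEquiv
  have hgL (v : E) : g (x + v) = x + L v := by
    have h := g.toRealAffineIsometryEquiv.map_vadd x v
    rw [IsometryEquiv.coeFn_toRealAffineIsometryEquiv, hgx, vadd_eq_add, vadd_eq_add] at h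
    rw [add_comm, h, add_comm]
  have hL (v : E) : L v = v ↔ ∃ t : ℝ, v = t • d := by
    have h := hfix (x + v)
    rw [hgL] at h
    simpa using h
  obtain ⟨T, a, hTsurj, hTle, hTL, hT0, hTnorm, hLinner⟩ :=
    L.exists_complex_coordinate_of_fixed_line hd hL
  have hgpow (k : ℕ) (v : E) : (g ^ k) (x + v) = x + (L ^ k) v := by
    induction k generalizing v with
    | zero => simp
    | succ k ih => rw [pow_succ, pow_succ, IsometryEquiv.mul_apply, hgL, ih]; rfl
  have hTpow (k : ℕ) (v : E) : T ((L ^ k) v) = a ^ k * T v := by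
    induction k generalizing v with
    | zero => simp
    | succ k ih => rw [pow_succ, LinearIsometryEquiv.coe_mul, Function.comp_apply, ih, hTL, pow_succ,
        mul_assoc]
  have hinnerpow (k : ℕ) (v : E) : inner ℝ d ((L ^ k) v) = inner ℝ d v := by
    induction k generalizing v with
    | zero => simp
    | succ k ih => rw [pow_succ, LinearIsometryEquiv.coe_mul, Function.comp_apply, ih, hLinner]
  have hdisp (k : ℕ) (v : E) : ‖(L ^ k) v - v‖ = ‖a ^ k - 1‖ * ‖T v‖ := by
    rw [← hTnorm _ (by rw [inner_sub_right, hinnerpow, sub_self]), map_sub, hTpow, ← norm_mul]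
    congr 1
    ring
  have hprim : IsPrimitiveRoot a n := by
    refine IsPrimitiveRoot.mk_of_lt a (by omega) ?_ fun l hl hln hal => ?_
    · obtain ⟨v, hv⟩ := hTsurj 1
      have h1 : g ^ n = 1 := horder ▸ pow_orderOf_eq_one g
      have h2 := hgpow n v
      rw [h1] at h2
      have h3 : (L ^ n) v = v := by simpa using h2.symm
      have h4 := hTpow n v
      rw [h3, hv, mul_one] at h4
      exact h4.symm
    · have h1 : g ^ l = 1 := by
        ext1 p
        obtain ⟨v, rfl⟩ : ∃ v, p = x + v := ⟨p - x, by abel⟩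
        have h2 := hdisp l v
        rw [hal, sub_self, norm_zero, zero_mul, norm_eq_zero, sub_eq_zero] at h2
        rw [hgpow, h2]
        rfl
      have h3 := orderOf_le_of_pow_eq_one hl h1
      omega
  have : NeZero n := ⟨by omega⟩
  -- Two opposite small rotations in the group generated by `g`.
  obtain ⟨z, hzn, hz1, hzim, hzlt⟩ := exists_root_of_unity_norm_sub_one_lt_one hn
  have hz0 : z ≠ 0 := by
    rintro rfl
    simp at hz1
  have hzne : z ≠ 1 := by
    rintro rfl
    simp at hzim
  have hzinv : ‖z⁻¹ - 1‖ = ‖z - 1‖ := by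
    rw [show z⁻¹ - 1 = -(z⁻¹ * (z - 1)) by field_simp; ring, norm_neg, norm_mul, norm_inv, hz1]
    simp
  obtain ⟨k, -, hk⟩ := hprim.eq_pow_of_pow_eq_one hzn
  obtain ⟨j, -, hj⟩ := hprim.eq_pow_of_pow_eq_one (ξ := z⁻¹) (by rw [inv_pow, hzn, inv_one])
  have hgpres (m : ℕ) (p : E) (hp : p ∈ X ∩ Metric.closedBall x (2 * R)) :
      (g ^ m) p ∈ X ∩ Metric.closedBall x (2 * R) := by
    induction m generalizing p with
    | zero => exact hp
    | succ m ih =>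
      rw [pow_succ, IsometryEquiv.mul_apply]
      exact ih _ (hg ▸ Set.mem_image_of_mem g hp)
  -- A point off the axis which is almost closest to `x` among such points.
  let S : Set ℝ := {r | ∃ v : E, x + v ∈ X ∧ ‖v‖ ≤ 2 * R ∧ T v ≠ 0 ∧ ‖v‖ = r}
  have hSge (r : ℝ) (hr : r ∈ S) : 1 ≤ r := by
    obtain ⟨v, hvX, -, hTv, rfl⟩ := hr
    have hne : x + v ≠ x := by
      intro h
      apply hTv
      rw [show v = 0 by simpa using h, map_zero]
    simpa using hpack _ hvX x hx hne
  have hSne : S.Nonempty := by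
    obtain ⟨w, hw⟩ := hTsurj 1
    let w' := w - inner ℝ d w • d
    have hw'd : inner ℝ d w' = 0 := by
      simp [w', inner_sub_right, inner_smul_right, hd]
    have hw' : ‖w'‖ = 1 := by
      rw [← hTnorm w' hw'd, map_sub, map_smul, (hT0 d).2 ⟨1, by simp⟩, hw]
      simp
    obtain ⟨q, hqX, hq, hqw⟩ :=
      exists_mem_closedBall_two_mul_inner_pos (by linarith) hpack hcover x hw'
    refine ⟨_, q - x, by simpa using hqX, by rwa [← dist_eq_norm], fun h => ?_, rfl⟩
    obtain ⟨t, ht⟩ := (hT0 _).1 h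
    rw [ht, inner_smul_right, real_inner_comm, hw'd, mul_zero] at hqw
    exact hqw.false
  have hSbdd : BddBelow S := ⟨1, hSge⟩
  have hrpos : 0 < sInf S := one_pos.trans_le (le_csInf hSne hSge)
  have hzpos : 0 < ‖z - 1‖ := norm_pos_iff.2 (sub_ne_zero.2 hzne)
  obtain ⟨-, ⟨v, hvX, hv2R, hTv, rfl⟩, hvlt⟩ :=
    exists_lt_of_csInf_lt hSne ((lt_div_iff₀ hzpos).2 (by nlinarith) : sInf S < sInf S / ‖z - 1‖)
  rw [lt_div_iff₀ hzpos] at hvlt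
  have hvmem : x + v ∈ X ∩ Metric.closedBall x (2 * R) := ⟨hvX, by simpa using hv2R⟩
  obtain ⟨f, hfx, hf⟩ := hequiv x hx (x + v) hvX
  let H : E ≃ₗᵢ[ℝ] E := f.toRealAffineIsometryEquiv.linearIsometryEquiv
  have hfH (w : E) : f (x + w) = x + v + H w := by
    have h := f.toRealAffineIsometryEquiv.map_vadd x w
    rw [IsometryEquiv.coeFn_toRealAffineIsometryEquiv, hfx, vadd_eq_add, vadd_eq_add] at h
    rw [add_comm, h, add_comm]
  -- Nearby points of the orbit lie on the transported axis.
  have haxis (m : ℕ) (hm : ‖a ^ m - 1‖ = ‖z - 1‖) :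
      ∃ t : ℝ, (a ^ m - 1) * T v = t * T (H d) := by
    have hlt : ‖(L ^ m) v - v‖ < sInf S := by
      rw [hdisp, hm, mul_comm]
      exact (mul_le_mul_of_nonneg_right (hTle v) hzpos.le).trans_lt hvlt
    have hle : sInf S ≤ 2 * R := (csInf_le hSbdd ⟨v, hvX, hv2R, hTv, rfl⟩).trans hv2R
    have hmem := hgpres m _ hvmem
    rw [hgpow] at hmem
    have hmem' : x + (L ^ m) v ∈ X ∩ Metric.closedBall (x + v) (2 * R) := by
      refine ⟨hmem.1, ?_⟩
      rw [Metric.mem_closedBall, dist_add_left, dist_eq_norm]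
      linarith
    rw [← hf] at hmem'
    obtain ⟨p, hp, hpeq⟩ := hmem'
    obtain ⟨w, rfl⟩ : ∃ w, p = x + w := ⟨p - x, by abel⟩
    rw [hfH, add_assoc, add_right_inj] at hpeq
    have hHw : H w = (L ^ m) v - v := eq_sub_of_add_eq' hpeq
    have hTw : T w = 0 := by
      by_contra h
      have h1 := csInf_le hSbdd ⟨w, hp.1, by simpa using hp.2, h, rfl⟩
      rw [← H.norm_map w, hHw] at h1
      linarith
    obtain ⟨t, rfl⟩ := (hT0 w).1 hTw
    refine ⟨t, ?_⟩
    have h1 := congrArg T hHw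
    rw [map_smul, map_smul, map_sub, hTpow, Complex.real_smul] at h1
    rw [h1]
    ring
  obtain ⟨t, ht⟩ := haxis k (by rw [hk])
  obtain ⟨s, hs⟩ := haxis j (by rw [hj, hzinv])
  rw [hk] at ht
  rw [hj] at hs
  -- Collinearity forces `z` to be real.
  have h1 : (t + s * z) * ((z - 1) * T v) = 0 := by
    have h2 : (1 - z) * T v = z * (s * T (H d)) := by
      rw [← hs]
      field_simp
    linear_combination s * z * ht - t * h2
  have h2 : (z - 1) * T v ≠ 0 := mul_ne_zero (sub_ne_zero.2 hzne) hTv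
  have h3 : (t + s * z : ℂ) = 0 := (mul_eq_zero.1 h1).resolve_right h2
  have h4 : s = 0 := by
    have := congrArg Complex.im h3
    simpa [hzim] using this
  have h5 : t = 0 := by simpa [h4] using h3
  exact h2 (by simpa [h5] using ht)
end

section
/- In ℝ³, any set of 13 or more distinct points on a sphere of radius ρ centered at a point x contains two points at distance strictly less than ρ from each other. -/
open Finset
open scoped RealInnerProductSpace ComplexConjugate

namespace KissingNumber

/-! ### Positive definite kernels on the circle and the sphere -/

/-- The polynomial expressing `Re (w ^ m)` through `r = Re w` and `q = |w|²`. -/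
def circularPoly (r q : ℝ) : ℕ → ℝ
  | 0 => 1
  | 1 => r
  | m + 2 => 2 * r * circularPoly r q (m + 1) - q * circularPoly r q m

theorem re_pow_eq_circularPoly (w : ℂ) :
    ∀ m : ℕ, (w ^ m).re = circularPoly w.re (Complex.normSq w) m
  | 0 => by simp [circularPoly]
  | 1 => by simp [circularPoly]
  | m + 2 => by
    rw [circularPoly, ← re_pow_eq_circularPoly w (m + 1), ← re_pow_eq_circularPoly w m]
    simp only [pow_succ, Complex.mul_re, Complex.mul_im, Complex.normSq_apply]
    ring

theorem sum_re_pow_nonneg {ι : Type*} (s : Finset ι) (a : ι → ℝ) (z : ι → ℂ) (m : ℕ) :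
    0 ≤ ∑ i ∈ s, ∑ j ∈ s, a i * a j * ((z i * conj (z j)) ^ m).re := by
  have h : ∑ i ∈ s, ∑ j ∈ s, a i * a j * ((z i * conj (z j)) ^ m).re =
      ((∑ i ∈ s, a i * z i ^ m) * conj (∑ i ∈ s, a i * z i ^ m)).re := by
    simp only [map_sum, Finset.sum_mul_sum, Complex.re_sum]
    refine sum_congr rfl fun i _ ↦ sum_congr rfl fun j _ ↦ ?_
    rw [← Complex.re_ofReal_mul]
    congr 1
    simp only [map_mul, map_pow, Complex.conj_ofReal, Complex.ofReal_mul]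
    ring
  rw [h, Complex.mul_conj, Complex.ofReal_re]
  exact Complex.normSq_nonneg _

variable {ι E : Type*} [NormedAddCommGroup E] [InnerProductSpace ℝ E]

/-- The projection of `x` to the plane orthogonal to `b 0`, as a complex number. -/
noncomputable def planePart (b : OrthonormalBasis (Fin 3) ℝ E) (x : E) : ℂ := ⟨⟪b 1, x⟫, ⟪b 2, x⟫⟩

theorem inner_eq_add_re_planePart (b : OrthonormalBasis (Fin 3) ℝ E) (x y : E) :
    ⟪x, y⟫ = ⟪b 0, x⟫ * ⟪b 0, y⟫ + (planePart b x * conj (planePart b y)).re := by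
  rw [← b.sum_inner_mul_inner x y, Fin.sum_univ_three]
  simp only [planePart, Complex.mul_re, Complex.conj_re, Complex.conj_im,
    real_inner_comm x]
  ring

theorem normSq_planePart (b : OrthonormalBasis (Fin 3) ℝ E) {x : E} (hx : ‖x‖ = 1) :
    Complex.normSq (planePart b x) = 1 - ⟪b 0, x⟫ ^ 2 := by
  have h := inner_eq_add_re_planePart b x x
  rw [Complex.mul_conj, Complex.ofReal_re, real_inner_self_eq_norm_sq, hx] at h
  linarith

/-- A zonal kernel with an addition formula with nonnegative coefficients is positive definite
on the unit sphere of a three-dimensional space. -/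
theorem sum_zonal_nonneg (b : OrthonormalBasis (Fin 3) ℝ E) {K : ℝ → ℝ} (n : ℕ) (c : ℕ → ℝ)
    (Q : ℕ → ℝ → ℝ) (hc : ∀ m, 0 ≤ c m)
    (hK : ∀ u v r, K (u * v + r) = ∑ m ∈ range (n + 1),
      c m * Q m u * Q m v * circularPoly r ((1 - u ^ 2) * (1 - v ^ 2)) m)
    {s : Finset ι} {y : ι → E} (hy : ∀ i ∈ s, ‖y i‖ = 1) :
    0 ≤ ∑ i ∈ s, ∑ j ∈ s, K ⟪y i, y j⟫ := by
  have h : ∑ i ∈ s, ∑ j ∈ s, K ⟪y i, y j⟫ = ∑ m ∈ range (n + 1), c m *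
      ∑ i ∈ s, ∑ j ∈ s, Q m ⟪b 0, y i⟫ * Q m ⟪b 0, y j⟫ *
        ((planePart b (y i) * conj (planePart b (y j))) ^ m).re := by
    simp only [mul_sum]
    rw [sum_comm]
    rw [sum_comm (s := range (n + 1))]
    rw [sum_comm]
    refine sum_congr rfl fun i hi ↦ ?_
    rw [sum_comm]
    refine sum_congr rfl fun j hj ↦ ?_
    rw [inner_eq_add_re_planePart b, hK]
    refine sum_congr rfl fun m _ ↦ ?_
    rw [re_pow_eq_circularPoly, Complex.normSq_mul, Complex.normSq_conj,
      normSq_planePart b (hy i hi), normSq_planePart b (hy j hj)]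
    ring
  rw [h]
  exact sum_nonneg fun m _ ↦ mul_nonneg (hc m) (sum_re_pow_nonneg s _ _ m)

noncomputable def legendreOne (t : ℝ) : ℝ := t

noncomputable def legendreTwo (t : ℝ) : ℝ := (3 * t^2 - 1) / 2

noncomputable def legendreThree (t : ℝ) : ℝ := (5 * t^3 - 3 * t) / 2

noncomputable def legendreFour (t : ℝ) : ℝ := (35 * t^4 - 30 * t^2 + 3) / 8

noncomputable def legendreNine (t : ℝ) : ℝ :=
  (12155 * t^9 - 25740 * t^7 + 18018 * t^5 - 4620 * t^3 + 315 * t) / 128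

theorem sum_legendre_one_nonneg (b : OrthonormalBasis (Fin 3) ℝ E) {s : Finset ι} {y : ι → E}
    (hy : ∀ i ∈ s, ‖y i‖ = 1) :
    0 ≤ ∑ i ∈ s, ∑ j ∈ s, legendreOne ⟪y i, y j⟫ := by
  refine sum_zonal_nonneg b 1 (fun | 0 => 1 | 1 => 1 | _ => 0)
    (fun | 0 => fun u => u | 1 => fun _ => 1 | _ => fun _ => 0) ?_ ?_ hy
  · intro m; split <;> norm_num
  · intro u v r
    simp only [legendreOne, Finset.sum_range_succ, Finset.sum_range_zero, circularPoly]
    ring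

theorem sum_legendre_two_nonneg (b : OrthonormalBasis (Fin 3) ℝ E) {s : Finset ι} {y : ι → E}
    (hy : ∀ i ∈ s, ‖y i‖ = 1) :
    0 ≤ ∑ i ∈ s, ∑ j ∈ s, legendreTwo ⟪y i, y j⟫ := by
  refine sum_zonal_nonneg b 2 (fun | 0 => 1 / 4 | 1 => 3 | 2 => 3 / 4 | _ => 0)
    (fun | 0 => fun u => 3 * u^2 - 1 | 1 => fun u => u | 2 => fun _ => 1 | _ => fun _ => 0) ?_ ?_ hy
  · intro m; split <;> norm_num
  · intro u v r
    simp only [legendreTwo, Finset.sum_range_succ, Finset.sum_range_zero, circularPoly]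
    ring

theorem sum_legendre_three_nonneg (b : OrthonormalBasis (Fin 3) ℝ E) {s : Finset ι} {y : ι → E}
    (hy : ∀ i ∈ s, ‖y i‖ = 1) :
    0 ≤ ∑ i ∈ s, ∑ j ∈ s, legendreThree ⟪y i, y j⟫ := by
  refine sum_zonal_nonneg b 3 (fun | 0 => 1 / 4 | 1 => 3 / 8 | 2 => 15 / 4 | 3 => 5 / 8 | _ => 0)
    (fun
      | 0 => fun u ↦ 5 * u^3 - 3 * u
      | 1 => fun u ↦ 5 * u^2 - 1
      | 2 => fun u ↦ u
      | 3 => fun _ ↦ 1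
      | _ => fun _ ↦ 0) ?_ ?_ hy
  · intro m; split <;> norm_num
  · intro u v r
    simp only [legendreThree, Finset.sum_range_succ, Finset.sum_range_zero, circularPoly]
    ring

theorem sum_legendre_four_nonneg (b : OrthonormalBasis (Fin 3) ℝ E) {s : Finset ι} {y : ι → E}
    (hy : ∀ i ∈ s, ‖y i‖ = 1) :
    0 ≤ ∑ i ∈ s, ∑ j ∈ s, legendreFour ⟪y i, y j⟫ := by
  refine sum_zonal_nonneg b 4 (fun
      | 0 => 1 / 64
      | 1 => 5 / 8
      | 2 => 5 / 16
      | 3 => 35 / 8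
      | 4 => 35 / 64
      | _ => 0)
    (fun
      | 0 => fun u ↦ 35 * u^4 - 30 * u^2 + 3
      | 1 => fun u ↦ 7 * u^3 - 3 * u
      | 2 => fun u ↦ 7 * u^2 - 1
      | 3 => fun u ↦ u
      | 4 => fun _ ↦ 1
      | _ => fun _ ↦ 0) ?_ ?_ hy
  · intro m; split <;> norm_num
  · intro u v r
    simp only [legendreFour, Finset.sum_range_succ, Finset.sum_range_zero, circularPoly]
    ring

theorem sum_legendre_nine_nonneg (b : OrthonormalBasis (Fin 3) ℝ E) {s : Finset ι} {y : ι → E}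
    (hy : ∀ i ∈ s, ‖y i‖ = 1) :
    0 ≤ ∑ i ∈ s, ∑ j ∈ s, legendreNine ⟪y i, y j⟫ := by
  refine sum_zonal_nonneg b 9 (fun
      | 0 => 1 / 16384
      | 1 => 45 / 16384
      | 2 => 495 / 2048
      | 3 => 1155 / 8192
      | 4 => 45045 / 4096
      | 5 => 1287 / 8192
      | 6 => 2145 / 2048
      | 7 => 6435 / 32768
      | 8 => 109395 / 16384
      | 9 => 12155 / 32768
      | _ => 0)
    (fun
      | 0 => fun u ↦ 12155 * u^9 - 25740 * u^7 + 18018 * u^5 - 4620 * u^3 + 315 * u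
      | 1 => fun u ↦ 2431 * u^8 - 4004 * u^6 + 2002 * u^4 - 308 * u^2 + 7
      | 2 => fun u ↦ 221 * u^7 - 273 * u^5 + 91 * u^3 - 7 * u
      | 3 => fun u ↦ 221 * u^6 - 195 * u^4 + 39 * u^2 - 1
      | 4 => fun u ↦ 17 * u^5 - 10 * u^3 + u
      | 5 => fun u ↦ 85 * u^4 - 30 * u^2 + 1
      | 6 => fun u ↦ 17 * u^3 - 3 * u
      | 7 => fun u ↦ 17 * u^2 - 1
      | 8 => fun u ↦ u
      | 9 => fun _ ↦ 1
      | _ => fun _ ↦ 0) ?_ ?_ hy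
  · intro m; split <;> norm_num
  · intro u v r
    simp only [legendreNine, Finset.sum_range_succ, Finset.sum_range_zero, circularPoly]
    ring

/-- A polynomial with nonnegative Legendre coefficients. -/
noncomputable def delsartePoly (t : ℝ) : ℝ :=
  1 + 73 / 50 * legendreOne t + 7 / 2 * legendreTwo t + 38 / 25 * legendreThree t +
    197 / 100 * legendreFour t + 6 / 25 * legendreNine t

theorem delsartePoly_eq (t : ℝ) : delsartePoly t =
    7293 / 320 * t^9 - 3861 / 80 * t^7 + 27027 / 800 * t^5 + 1379 / 160 * t^4 - 389 / 80 * t^3 -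
      171 / 80 * t^2 - 367 / 1600 * t - 9 / 800 := by
  unfold delsartePoly legendreOne legendreTwo legendreThree legendreFour legendreNine
  ring

theorem delsartePoly_one : delsartePoly 1 = 969 / 100 := by
  rw [delsartePoly_eq]
  norm_num

theorem delsartePoly_nonpos {t : ℝ} (h₁ : -(14 / 25) ≤ t) (h₂ : t ≤ 1 / 2) :
    delsartePoly t ≤ 0 := by
  rcases le_total t (-(6 / 25)) with h₃ | h₃
  · obtain ⟨x, hx⟩ : ∃ x, x = 25 * t + 14 := ⟨_, rfl⟩
    obtain ⟨y, hy⟩ : ∃ y, y = -6 - 25 * t := ⟨_, rfl⟩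
    have hx0 : 0 ≤ x := by linarith
    have hy0 : 0 ≤ y := by linarith
    have h : 0 - delsartePoly t =
        (313381166964 * y^9 + 16857789085879 * x * y^8 + 52235935481864 * x^2 * y^7 +
          46474374679364 * x^3 * y^6 + 2404272597984 * x^4 * y^5 + 3446279605386 * x^5 * y^4 +
          32770837311896 * x^6 * y^3 + 29820782727236 * x^7 * y^2 + 10256501559436 * x^8 * y +
          1259345783991 * x^9) / 20480000000000000000000 := by
      rw [hx, hy, delsartePoly_eq]
      ring
    have : 0 ≤ 0 - delsartePoly t := by rw [h]; positivity
    linarith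
  rcases le_total t (2 / 25) with h₄ | h₄
  · obtain ⟨x, hx⟩ : ∃ x, x = 25 * t + 6 := ⟨_, rfl⟩
    obtain ⟨y, hy⟩ : ∃ y, y = 2 - 25 * t := ⟨_, rfl⟩
    have hx0 : 0 ≤ x := by linarith
    have hy0 : 0 ≤ y := by linarith
    have h : 0 - delsartePoly t =
        (1259345783991 * y^9 + 12411722552402 * x * y^8 + 47062550670964 * x^2 * y^7 +
          82272313054528 * x^3 * y^6 + 59070382848986 * x^4 * y^5 + 6027902851588 * x^5 * y^4 +
          11987875686036 * x^6 * y^3 + 42589754642352 * x^7 * y^2 + 30957175976679 * x^8 * y +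
          6913281629498 * x^9) / 20480000000000000000000 := by
      rw [hx, hy, delsartePoly_eq]
      ring
    have : 0 ≤ 0 - delsartePoly t := by rw [h]; positivity
    linarith
  · obtain ⟨x, hx⟩ : ∃ x, x = 25 * t - 2 := ⟨_, rfl⟩
    obtain ⟨y, hy⟩ : ∃ y, y = 1 - 2 * t := ⟨_, rfl⟩
    have hx0 : 0 ≤ x := by linarith
    have hy0 : 0 ≤ y := by linarith
    have h : 0 - delsartePoly t =
        (276531265179920 * y^9 + 330404417422515 * x * y^8 + 167066447754420 * x^2 * y^7 +
          46244348881500 * x^3 * y^6 + 7624228242582 * x^4 * y^5 + 763736574510 * x^5 * y^4 +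
          45249754200 * x^6 * y^3 + 1448574660 * x^7 * y^2 + 19394334 * x^8 * y +
          5119 * x^9) / 1270848074529600 := by
      rw [hx, hy, delsartePoly_eq]
      ring
    have : 0 ≤ 0 - delsartePoly t := by rw [h]; positivity
    linarith

/-- The slopes of the affine majorants of `delsartePoly`. -/
noncomputable def slope : Fin 4 → ℝ := ![103 / 100, 21 / 5, 373 / 50, 631 / 50]

/-- The offsets of the affine majorants of `delsartePoly`. -/
noncomputable def offset : Fin 4 → ℝ := ![721 / 1250, 2669 / 1000, 25407 / 5000, 46563 / 5000]

theorem exists_delsartePoly_le_affine {t : ℝ} (h₁ : -1 ≤ t) (h₂ : t ≤ -(14 / 25)) :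
    ∃ l, delsartePoly t ≤ slope l * -t - offset l := by
  rcases le_total (-(33 / 50)) t with h₃ | h₃
  · obtain ⟨x, hx⟩ : ∃ x, x = 50 * t + 33 := ⟨_, rfl⟩
    obtain ⟨y, hy⟩ : ∃ y, y = -14 - 25 * t := ⟨_, rfl⟩
    have hx0 : 0 ≤ x := by linarith
    have hy0 : 0 ≤ y := by linarith
    have h : -(103/100) * t - 721/1250 - delsartePoly t =
        (151002053973229 * y^9 + 36002514664493238 * x * y^8 +
          119124150755935116 * x^2 * y^7 + 169841438637991832 * x^3 * y^6 +
          134860576336369234 * x^4 * y^5 + 64470981509910622 * x^5 * y^4 +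
          18619446856688484 * x^6 * y^3 + 3038511870203588 * x^7 * y^2 +
          226404938876801 * x^8 * y + 2507049335712 * x^9) / 2384185791015625000000 := by
      rw [hx, hy, delsartePoly_eq]
      ring
    have : 0 ≤ -(103/100) * t - 721/1250 - delsartePoly t := by rw [h]; positivity
    refine ⟨0, ?_⟩
    simp only [slope, offset, Fin.isValue, Matrix.cons_val]
    linarith
  rcases le_total (-(37 / 50)) t with h₄ | h₄
  · obtain ⟨x, hx⟩ : ∃ x, x = 50 * t + 37 := ⟨_, rfl⟩
    obtain ⟨y, hy⟩ : ∃ y, y = -33 - 50 * t := ⟨_, rfl⟩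
    have hx0 : 0 ≤ x := by linarith
    have hy0 : 0 ≤ y := by linarith
    have h : -(21/5) * t - 2669/1000 - delsartePoly t =
        (27975119942866561 * y^9 + 311894032709468341 * x * y^8 +
          1386937747370068676 * x^2 * y^7 + 3337455701676858596 * x^3 * y^6 +
          4842011089573252446 * x^4 * y^5 + 4382627820463084614 * x^5 * y^4 +
          2432935159758543284 * x^6 * y^3 + 761072767640707124 * x^7 * y^2 +
          103342209811177129 * x^8 * y + 151002053973229 * x^9) / 163840000000000000000000 := by
      rw [hx, hy, delsartePoly_eq]
      ring
    have : 0 ≤ -(21/5) * t - 2669/1000 - delsartePoly t := by rw [h]; positivity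
    refine ⟨1, ?_⟩
    simp only [slope, offset, Fin.isValue, Matrix.cons_val]
    linarith
  rcases le_total (-(41 / 50)) t with h₅ | h₅
  · obtain ⟨x, hx⟩ : ∃ x, x = 50 * t + 41 := ⟨_, rfl⟩
    obtain ⟨y, hy⟩ : ∃ y, y = -37 - 50 * t := ⟨_, rfl⟩
    have hx0 : 0 ≤ x := by linarith
    have hy0 : 0 ≤ y := by linarith
    have h : -(373/50) * t - 25407/5000 - delsartePoly t =
        (20289157182247573 * y^9 + 306872921095247849 * x * y^8 +
          1606401577258650772 * x^2 * y^7 + 4352720635408412276 * x^3 * y^6 +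
          7017077213310585398 * x^4 * y^5 + 7092628599513888286 * x^5 * y^4 +
          4510821699649977668 * x^6 * y^3 + 1729050495791360004 * x^7 * y^2 +
          354658126262129757 * x^8 * y + 27975119942866561 * x^9) / 163840000000000000000000 := by
      rw [hx, hy, delsartePoly_eq]
      ring
    have : 0 ≤ -(373/50) * t - 25407/5000 - delsartePoly t := by rw [h]; positivity
    refine ⟨2, ?_⟩
    simp only [slope, offset, Fin.isValue, Matrix.cons_val]
    linarith
  refine ⟨3, ?_⟩
  simp only [slope, offset, Fin.isValue, Matrix.cons_val]
  rcases le_total (-(19 / 20)) t with h₆ | h₆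
  · obtain ⟨x, hx⟩ : ∃ x, x = 20 * t + 19 := ⟨_, rfl⟩
    obtain ⟨y, hy⟩ : ∃ y, y = -41 - 50 * t := ⟨_, rfl⟩
    have hx0 : 0 ≤ x := by linarith
    have hy0 : 0 ≤ y := by linarith
    have h : -(631/50) * t - 46563/5000 - delsartePoly t =
        (1854958527847 * y^9 + 92305098507597 * x * y^8 + 1774591861655532 * x^2 * y^7 +
          15656614464667412 * x^3 * y^6 + 75263013403467202 * x^4 * y^5 +
          213021740947268678 * x^5 * y^4 + 359778584224196828 * x^6 * y^3 +
          345095165775132868 * x^7 * y^2 + 159965136660328463 * x^8 * y +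
          20289157182247573 * x^9) / 3393439799360000000000 := by
      rw [hx, hy, delsartePoly_eq]
      ring
    have : 0 ≤ -(631/50) * t - 46563/5000 - delsartePoly t := by rw [h]; positivity
    linarith
  · obtain ⟨x, hx⟩ : ∃ x, x = t + 1 := ⟨_, rfl⟩
    obtain ⟨y, hy⟩ : ∃ y, y = -19 - 20 * t := ⟨_, rfl⟩
    have hx0 : 0 ≤ x := by linarith
    have hy0 : 0 ≤ y := by linarith
    have h : -(631/50) * t - 46563/5000 - delsartePoly t =
        (2296 * y^9 + 261280 * x * y^8 + 11967400 * x^2 * y^7 + 271063000 * x^3 * y^6 +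
          2821189250 * x^4 * y^5 + 5948449400 * x^5 * y^4 + 21902015000 * x^6 * y^3 +
          3976951452000 * x^7 * y^2 + 55717829084625 * x^8 * y + 231869815980875 * x^9) / 40000
            := by
      rw [hx, hy, delsartePoly_eq]
      ring
    have : 0 ≤ -(631/50) * t - 46563/5000 - delsartePoly t := by rw [h]; positivity
    linarith

/-! ### Points in a spherical cap -/

theorem half_sub_mul_le {u v p q : ℝ} (hu : 14 / 25 ≤ u) (hv : 14 / 25 ≤ v) (hp : 0 ≤ p)
    (hq : 0 ≤ q) (hup : p ^ 2 = 1 - u ^ 2) (hvq : q ^ 2 = 1 - v ^ 2) :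
    1 / 2 - u * v ≤ 11 / 40 * (p * q) := by
  rcases le_total (1 / 2) (u * v) with h | h
  · have := mul_nonneg hp hq
    linarith
  refine le_of_sq_le_sq ?_ (by positivity)
  have h₁ : (11 / 40 * (p * q)) ^ 2 = (11 / 40) ^ 2 * ((1 - u ^ 2) * (1 - v ^ 2)) := by
    rw [← hup, ← hvq]
    ring
  rw [h₁]
  have h₂ : 0 ≤ (u ^ 2 - (14 / 25) ^ 2) * (v ^ 2 - (14 / 25) ^ 2) :=
    mul_nonneg (by nlinarith) (by nlinarith)
  have h₃ : (14 / 25) ^ 2 ≤ u * v := by nlinarith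
  nlinarith [mul_nonneg (sub_nonneg.2 h) (sub_nonneg.2 h₃)]

/-- At most four unit complex numbers have pairwise inner products at most `11 / 40`. -/
theorem card_le_four_of_re_mul_conj_le {s : Finset ι} {z : ι → ℂ}
    (hz : ∀ i ∈ s, Complex.normSq (z i) = 1)
    (hs : ∀ i ∈ s, ∀ j ∈ s, i ≠ j → (z i * conj (z j)).re ≤ 11 / 40) : s.card ≤ 4 := by
  classical
  set c : ι → ι → ℝ := fun i j ↦ (z i * conj (z j)).re with hc
  have hq : ∀ i ∈ s, ∀ j ∈ s, Complex.normSq (z i * conj (z j)) = 1 := fun i hi j hj ↦ by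
    rw [Complex.normSq_mul, Complex.normSq_conj, hz i hi, hz j hj, one_mul]
  have hk (m : ℕ) : 0 ≤ ∑ i ∈ s, ∑ j ∈ s, circularPoly (c i j) 1 m := by
    have h := sum_re_pow_nonneg s (fun _ ↦ 1) z m
    refine h.trans_eq (sum_congr rfl fun i hi ↦ sum_congr rfl fun j hj ↦ ?_)
    rw [re_pow_eq_circularPoly, hq i hi j hj, one_mul, one_mul]
  have hdiag : ∀ i ∈ s, c i i = 1 := fun i hi ↦ by
    simp only [hc, Complex.mul_conj, Complex.ofReal_re, hz i hi]
  have hub : ∑ i ∈ s, ∑ j ∈ s, (c i j + 4 / 5) ^ 2 * (c i j - 11 / 40) ≤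
      (s.card : ℝ) * (2349 / 1000) := by
    rw [← nsmul_eq_mul, ← sum_const]
    refine sum_le_sum fun i hi ↦ ?_
    rw [← add_sum_erase s _ hi, hdiag i hi]
    have : ∑ j ∈ s.erase i, (c i j + 4 / 5) ^ 2 * (c i j - 11 / 40) ≤ 0 :=
      sum_nonpos fun j hj ↦ mul_nonpos_of_nonneg_of_nonpos (sq_nonneg _)
        (sub_nonpos.2 (hs i hi j (mem_of_mem_erase hj) (ne_of_mem_erase hj).symm))
    linarith
  have hexp : ∑ i ∈ s, ∑ j ∈ s, (c i j + 4 / 5) ^ 2 * (c i j - 11 / 40) =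
      973 / 2000 * (s.card : ℝ) ^ 2 + 19 / 20 * ∑ i ∈ s, ∑ j ∈ s, circularPoly (c i j) 1 1 +
        53 / 80 * ∑ i ∈ s, ∑ j ∈ s, circularPoly (c i j) 1 2 +
        1 / 4 * ∑ i ∈ s, ∑ j ∈ s, circularPoly (c i j) 1 3 := by
    have hcard : (s.card : ℝ) ^ 2 = ∑ i ∈ s, ∑ j ∈ s, (1 : ℝ) := by simp [sq]
    rw [hcard]
    simp only [mul_sum, ← sum_add_distrib]
    refine sum_congr rfl fun i _ ↦ sum_congr rfl fun j _ ↦ ?_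
    simp only [circularPoly]
    ring
  by_contra! h
  have h5 : (5 : ℝ) ≤ s.card := by exact_mod_cast h
  nlinarith [hk 1, hk 2, hk 3]

theorem exists_orthonormalBasis_apply_zero (hE : Module.finrank ℝ E = 3) {e : E}
    (he : ‖e‖ = 1) : ∃ b : OrthonormalBasis (Fin 3) ℝ E, b 0 = e := by
  have : FiniteDimensional ℝ E := .of_finrank_pos (by omega)
  have hv : Orthonormal ℝ (({0} : Set (Fin 3)).domRestrict fun _ ↦ e) := by
    rw [orthonormal_iff_ite]
    rintro ⟨i, rfl⟩ ⟨j, rfl⟩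
    simp [Set.domRestrict, he]
  obtain ⟨b, hb⟩ := hv.exists_orthonormalBasis_extension_of_card_eq (by simpa using hE)
  exact ⟨b, hb 0 rfl⟩

theorem card_le_four_of_inner_ge (hE : Module.finrank ℝ E = 3) {s : Finset ι} {y : ι → E}
    {e : E} (he : ‖e‖ = 1) (hy : ∀ i ∈ s, ‖y i‖ = 1)
    (hs : ∀ i ∈ s, ∀ j ∈ s, i ≠ j → ⟪y i, y j⟫ ≤ 1 / 2) (hcap : ∀ i ∈ s, 14 / 25 ≤ ⟪e, y i⟫) :
    s.card ≤ 4 := by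
  rcases le_or_gt s.card 1 with h1 | h1
  · omega
  obtain ⟨b, rfl⟩ := exists_orthonormalBasis_apply_zero hE he
  have hpos : ∀ i ∈ s, 0 < Complex.normSq (planePart b (y i)) := fun i hi ↦ by
    refine (Complex.normSq_nonneg _).lt_of_ne' fun h0 ↦ ?_
    obtain ⟨j, hj, hji⟩ := exists_mem_ne h1 i
    have hin := hs i hi j hj hji.symm
    rw [inner_eq_add_re_planePart b, Complex.normSq_eq_zero.1 h0, zero_mul, Complex.zero_re] at hin
    rw [normSq_planePart b (hy i hi)] at h0
    have := hcap i hi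
    have := hcap j hj
    nlinarith
  have hnorm : ∀ i ∈ s, 0 < ‖planePart b (y i)‖ := fun i hi ↦ by
    have := hpos i hi
    exact norm_pos_iff.2 (Complex.normSq_pos.1 this)
  have hsq : ∀ i ∈ s, ‖planePart b (y i)‖ ^ 2 = 1 - ⟪b 0, y i⟫ ^ 2 := fun i hi ↦ by
    rw [← Complex.normSq_eq_norm_sq, normSq_planePart b (hy i hi)]
  refine card_le_four_of_re_mul_conj_le
    (z := fun i ↦ ((‖planePart b (y i)‖⁻¹ : ℝ) : ℂ) * planePart b (y i)) ?_ ?_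
  · intro i hi
    rw [Complex.normSq_mul, Complex.normSq_ofReal, Complex.normSq_eq_norm_sq]
    field_simp [(hnorm i hi).ne']
  · intro i hi j hj hij
    have h := half_sub_mul_le (hcap i hi) (hcap j hj) (hnorm i hi).le (hnorm j hj).le
      (hsq i hi) (hsq j hj)
    have hin := hs i hi j hj hij
    rw [inner_eq_add_re_planePart b] at hin
    have heq : (((‖planePart b (y i)‖⁻¹ : ℝ) : ℂ) * planePart b (y i) *
        conj (((‖planePart b (y j)‖⁻¹ : ℝ) : ℂ) * planePart b (y j))).re =
        (planePart b (y i) * conj (planePart b (y j))).re /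
          (‖planePart b (y i)‖ * ‖planePart b (y j)‖) := by
      rw [map_mul, Complex.conj_ofReal, div_eq_inv_mul, mul_inv, ← Complex.re_ofReal_mul]
      congr 1
      push_cast
      ring
    rw [heq, div_le_iff₀ (mul_pos (hnorm i hi) (hnorm j hj))]
    linarith

theorem norm_sum_smul_sq_le {s : Finset ι} {y : ι → E} {a : ι → ℝ} (ha : ∀ i ∈ s, 0 ≤ a i)
    (hy : ∀ i ∈ s, ‖y i‖ = 1) (hs : ∀ i ∈ s, ∀ j ∈ s, i ≠ j → ⟪y i, y j⟫ ≤ 1 / 2) :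
    ‖∑ i ∈ s, a i • y i‖ ^ 2 ≤ ((∑ i ∈ s, a i) ^ 2 + ∑ i ∈ s, a i ^ 2) / 2 := by
  classical
  rw [← real_inner_self_eq_norm_sq, sum_inner, sq (∑ i ∈ s, a i), sum_mul_sum,
    ← sum_add_distrib, sum_div]
  refine sum_le_sum fun i hi ↦ ?_
  rw [inner_sum, ← add_sum_erase s _ hi, ← add_sum_erase s (fun j ↦ a i * a j) hi]
  simp only [real_inner_smul_left, real_inner_smul_right]
  rw [real_inner_self_eq_norm_sq, hy i hi]
  have : ∑ j ∈ s.erase i, a j * (a i * ⟪y i, y j⟫) ≤ (∑ j ∈ s.erase i, a i * a j) / 2 := by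
    rw [sum_div]
    refine sum_le_sum fun j hj ↦ ?_
    have h := hs i hi j (mem_of_mem_erase hj) (ne_of_mem_erase hj).symm
    have := mul_nonneg (ha i hi) (ha j (mem_of_mem_erase hj))
    nlinarith
  linarith

theorem level_bound {n₀ n₁ n₂ n₃ : ℕ} (h : n₀ + n₁ + n₂ + n₃ ≤ 4) :
    5000 * ((103 * n₀ + 420 * n₁ + 746 * n₂ + 1262 * n₃) ^ 2 +
      (103 ^ 2 * n₀ + 420 ^ 2 * n₁ + 746 ^ 2 * n₂ + 1262 ^ 2 * n₃)) ≤
      (33080 + 5768 * n₀ + 26690 * n₁ + 50814 * n₂ + 93126 * n₃) ^ 2 := by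
  have h₀ : n₀ ≤ 4 := by omega
  have h₁ : n₁ ≤ 4 := by omega
  have h₂ : n₂ ≤ 4 := by omega
  have h₃ : n₃ ≤ 4 := by omega
  interval_cases n₀ <;> interval_cases n₁ <;> interval_cases n₂ <;> interval_cases n₃ <;>
    omega

theorem sum_affine_le {s : Finset ι} {y : ι → E} {e : E} (he : ‖e‖ = 1)
    (hy : ∀ i ∈ s, ‖y i‖ = 1) (hs : ∀ i ∈ s, ∀ j ∈ s, i ≠ j → ⟪y i, y j⟫ ≤ 1 / 2)
    (hcard : s.card ≤ 4) (l : ι → Fin 4) :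
    ∑ i ∈ s, (slope (l i) * ⟪e, y i⟫ - offset (l i)) ≤ 827 / 250 := by
  classical
  set n : Fin 4 → ℕ := fun k ↦ {i ∈ s | l i = k}.card with hn
  have hfib (F : Fin 4 → ℝ) : ∑ i ∈ s, F (l i) = ∑ k, n k * F k := by
    rw [← sum_fiberwise s l]
    refine sum_congr rfl fun k _ ↦ ?_
    rw [hn, ← nsmul_eq_mul, ← sum_const]
    exact sum_congr rfl fun i hi ↦ by rw [(mem_filter.1 hi).2]
  have hn4 : n 0 + n 1 + n 2 + n 3 ≤ 4 := by
    have h := hfib fun _ ↦ 1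
    simp only [sum_const, nsmul_eq_mul, mul_one, Fin.sum_univ_four] at h
    have : s.card = n 0 + n 1 + n 2 + n 3 := by exact_mod_cast h
    omega
  have hslope : ∀ k, 0 ≤ slope k := by
    intro k
    fin_cases k <;> norm_num [slope]
  have hcs : ∑ i ∈ s, slope (l i) * ⟪e, y i⟫ ≤ ‖∑ i ∈ s, slope (l i) • y i‖ := by
    have h := real_inner_le_norm e (∑ i ∈ s, slope (l i) • y i)
    rw [he, one_mul, inner_sum] at h
    simpa only [real_inner_smul_right] using h
  have hsq := norm_sum_smul_sq_le (fun i _ ↦ hslope (l i)) hy hs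
  rw [hfib, hfib fun k ↦ slope k ^ 2] at hsq
  have hnum : (5000 * ((103 * n 0 + 420 * n 1 + 746 * n 2 + 1262 * n 3) ^ 2 +
      (103 ^ 2 * n 0 + 420 ^ 2 * n 1 + 746 ^ 2 * n 2 + 1262 ^ 2 * n 3)) : ℝ) ≤
      (33080 + 5768 * n 0 + 26690 * n 1 + 50814 * n 2 + 93126 * n 3) ^ 2 := by
    exact_mod_cast level_bound hn4
  have hoff := hfib offset
  rw [sum_sub_distrib, hoff]
  simp only [Fin.sum_univ_four, slope, offset, Fin.isValue, Matrix.cons_val] at hsq ⊢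
  refine sub_le_iff_le_add.2 (hcs.trans (le_of_sq_le_sq (hsq.trans ?_) (by positivity)))
  linarith

/-- The kissing number of a three-dimensional space is at most `12`. -/
theorem card_le_twelve (hE : Module.finrank ℝ E = 3) {s : Finset ι} {y : ι → E}
    (hy : ∀ i ∈ s, ‖y i‖ = 1) (hs : ∀ i ∈ s, ∀ j ∈ s, i ≠ j → ⟪y i, y j⟫ ≤ 1 / 2) :
    s.card ≤ 12 := by
  classical
  have : FiniteDimensional ℝ E := .of_finrank_pos (by omega)
  let b : OrthonormalBasis (Fin 3) ℝ E := (stdOrthonormalBasis ℝ E).reindex (finCongr hE)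
  have hrow : ∀ i ∈ s, ∑ j ∈ s, delsartePoly ⟪y i, y j⟫ ≤ 6499 / 500 := fun i hi ↦ by
    rw [← add_sum_erase s _ hi, real_inner_self_eq_norm_sq, hy i hi, one_pow, delsartePoly_one,
      ← sum_filter_add_sum_filter_not (s.erase i) fun j ↦ ⟪y i, y j⟫ ≤ -(14 / 25)]
    have hfar : ∑ j ∈ s.erase i with ¬⟪y i, y j⟫ ≤ -(14 / 25), delsartePoly ⟪y i, y j⟫ ≤ 0 := by
      refine sum_nonpos fun j hj ↦ ?_
      obtain ⟨hj, hij⟩ := mem_filter.1 hj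
      exact delsartePoly_nonpos (not_le.1 hij).le
        (hs i hi j (mem_of_mem_erase hj) (ne_of_mem_erase hj).symm)
    set t := {j ∈ s.erase i | ⟪y i, y j⟫ ≤ -(14 / 25)} with ht
    have hts : ∀ j ∈ t, j ∈ s := fun j hj ↦ mem_of_mem_erase (mem_filter.1 hj).1
    have hlevel : ∀ j, ∃ l, j ∈ t →
        delsartePoly ⟪y i, y j⟫ ≤ slope l * ⟪-y i, y j⟫ - offset l := fun j ↦ by
      by_cases hj : j ∈ t
      · have hge := neg_le_of_abs_le (abs_real_inner_le_norm (y i) (y j))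
        rw [hy i hi, hy j (hts j hj), one_mul] at hge
        obtain ⟨l, hl⟩ := exists_delsartePoly_le_affine hge (mem_filter.1 hj).2
        exact ⟨l, fun _ ↦ by rwa [inner_neg_left]⟩
      · exact ⟨0, fun h ↦ absurd h hj⟩
    choose l hl using hlevel
    have he : ‖-y i‖ = 1 := by rw [norm_neg, hy i hi]
    have hyt : ∀ j ∈ t, ‖y j‖ = 1 := fun j hj ↦ hy j (hts j hj)
    have hst : ∀ j ∈ t, ∀ k ∈ t, j ≠ k → ⟪y j, y k⟫ ≤ 1 / 2 :=
      fun j hj k hk ↦ hs j (hts j hj) k (hts k hk)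
    have hcard := card_le_four_of_inner_ge hE he hyt hst fun j hj ↦ by
      rw [inner_neg_left]
      linarith [(mem_filter.1 hj).2]
    have := (sum_le_sum hl).trans (sum_affine_le he hyt hst hcard l)
    linarith
  have hub : ∑ i ∈ s, ∑ j ∈ s, delsartePoly ⟪y i, y j⟫ ≤ (s.card : ℝ) * (6499 / 500) := by
    rw [← nsmul_eq_mul, ← sum_const]
    exact sum_le_sum hrow
  have hlb : (s.card : ℝ) ^ 2 ≤ ∑ i ∈ s, ∑ j ∈ s, delsartePoly ⟪y i, y j⟫ := by
    have hcard : (s.card : ℝ) ^ 2 = ∑ i ∈ s, ∑ j ∈ s, (1 : ℝ) := by simp [sq]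
    simp only [delsartePoly, sum_add_distrib, ← mul_sum]
    linarith [sum_legendre_one_nonneg b hy, sum_legendre_two_nonneg b hy,
      sum_legendre_three_nonneg b hy, sum_legendre_four_nonneg b hy,
      sum_legendre_nine_nonneg b hy]
  by_contra! h
  have h13 : (13 : ℝ) ≤ s.card := by exact_mod_cast h
  nlinarith

end KissingNumber

/-- In `ℝ³`, any set of 13 or more distinct points on a sphere of radius `ρ > 0` centered
at `x` contains two points at distance strictly less than `ρ` from each other (the kissing
number of `ℝ³` is 12). -/
theorem thirteen_points_on_sphere_close_pair
    (ρ : ℝ) (hρ : 0 < ρ) (x : EuclideanSpace ℝ (Fin 3))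
    (s : Finset (EuclideanSpace ℝ (Fin 3)))
    (hcard : 13 ≤ s.card)
    (hsphere : ∀ p ∈ s, dist x p = ρ) :
    ∃ p ∈ s, ∃ q ∈ s, p ≠ q ∧ dist p q < ρ := by
  by_contra! h
  have hnorm : ∀ p ∈ s, ‖p - x‖ = ρ := fun p hp ↦ by
    rw [← dist_eq_norm, dist_comm, hsphere p hp]
  refine absurd (KissingNumber.card_le_twelve (s := s) (y := fun p ↦ ρ⁻¹ • (p - x))
    (by simp) ?_ ?_) (by omega)
  · intro p hp
    rw [norm_smul, hnorm p hp, norm_inv, Real.norm_of_nonneg hρ.le, inv_mul_cancel₀ hρ.ne']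
  · intro p hp q hq hpq
    have hd := h p hp q hq hpq
    have hsub := norm_sub_sq_real (p - x) (q - x)
    rw [sub_sub_sub_cancel_right, ← dist_eq_norm, hnorm p hp, hnorm q hq] at hsub
    rw [real_inner_smul_left, real_inner_smul_right, ← mul_assoc, ← mul_inv, inv_mul_le_iff₀ (by
      positivity)]
    nlinarith
end
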